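/- Let R be an integral domain and t ∈ R. Let F be the pair of polynomials F = (X + (t+1)Y + 3X² − t³Y² − tX² − tX⁴ − 2t²XY + 2tXY − 2t²X²Y − 2tX³ + 2X³, t²Y + (t−1)X + tX²) with coefficients in R. Then the R-algebra endomorphism F̃ of R[X, Y, Z] sending X and Y to the two coordinates of F and fixing Z is an automorphism of R[X, Y, Z], and F̃ belongs to Tame₃(R). In particular, F induces an R-algebra automorphism of R[X,Y] which is stably tame with one added variable. -/

import Mathlib

noncomputable section

/-- `σ` is an affine automorphism of `S[X₁,…,Xₙ]`:
`Xᵢ ↦ Σⱼ aᵢⱼ Xⱼ + bᵢ` with `(aᵢⱼ) ∈ GLₙ(S)` and `bᵢ ∈ S`. -/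
def IsAffineAut {S : Type*} [CommRing S] {n : ℕ}
    (σ : MvPolynomial (Fin n) S ≃ₐ[S] MvPolynomial (Fin n) S) : Prop :=
  ∃ M : Matrix (Fin n) (Fin n) S, IsUnit M.det ∧ ∃ b : Fin n → S,
    ∀ i, σ (MvPolynomial.X i) =
      (∑ j, MvPolynomial.C (M i j) * MvPolynomial.X j) + MvPolynomial.C (b i)

/-- `σ` is an elementary automorphism of `S[X₁,…,Xₙ]`: it sends one variable `Xᵢ` to
`Xᵢ + f` where `f` is a polynomial in the remaining variables, and fixes the others. -/
def IsElementaryAut {S : Type*} [CommRing S] {n : ℕ}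
    (σ : MvPolynomial (Fin n) S ≃ₐ[S] MvPolynomial (Fin n) S) : Prop :=
  ∃ (i : Fin n) (f : MvPolynomial (Fin n) S),
    f ∈ MvPolynomial.supported S {j | j ≠ i} ∧
    σ (MvPolynomial.X i) = MvPolynomial.X i + f ∧
    ∀ j, j ≠ i → σ (MvPolynomial.X j) = MvPolynomial.X j

/-- The tame subgroup `Tameₙ(S)` of the group of `S`-algebra automorphisms of
`S[X₁,…,Xₙ]`, generated by the affine and the elementary automorphisms. -/
def TameSubgroup (S : Type*) [CommRing S] (n : ℕ) :
    Subgroup (MvPolynomial (Fin n) S ≃ₐ[S] MvPolynomial (Fin n) S) :=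
  Subgroup.closure {σ | IsAffineAut σ ∨ IsElementaryAut σ}

/-- `SL_m(S[X₁,…,Xₙ]) = E_m(S[X₁,…,Xₙ])` for all `n, m ≥ 0`: every matrix of
determinant one over every polynomial ring over `S` is a product of elementary
matrices (transvections). -/
def SLeqE (S : Type*) [CommRing S] : Prop :=
  ∀ (n m : ℕ) (M : Matrix.SpecialLinearGroup (Fin m) (MvPolynomial (Fin n) S)),
    M ∈ Subgroup.closure {A : Matrix.SpecialLinearGroup (Fin m) (MvPolynomial (Fin n) S) |
      ∃ (i j : Fin m) (c : MvPolynomial (Fin n) S), i ≠ j ∧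
        (A : Matrix (Fin m) (Fin m) (MvPolynomial (Fin n) S)) = Matrix.transvection i j c}

/-- First coordinate of the length-four example:
`X + (t+1)Y + 3X² − t³Y² − tX² − tX⁴ − 2t²XY + 2tXY − 2t²X²Y − 2tX³ + 2X³`. -/
def exP {R : Type*} [CommRing R] (t : R) {n : ℕ} (x y : MvPolynomial (Fin n) R) :
    MvPolynomial (Fin n) R :=
  x + MvPolynomial.C (t + 1) * y + 3 * x ^ 2 - MvPolynomial.C (t ^ 3) * y ^ 2
    - MvPolynomial.C t * x ^ 2 - MvPolynomial.C t * x ^ 4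
    - MvPolynomial.C (2 * t ^ 2) * x * y + MvPolynomial.C (2 * t) * x * y
    - MvPolynomial.C (2 * t ^ 2) * x ^ 2 * y - MvPolynomial.C (2 * t) * x ^ 3
    + 2 * x ^ 3

/-- Second coordinate of the length-four example: `t²Y + (t−1)X + tX²`. -/
def exQ {R : Type*} [CommRing R] (t : R) {n : ℕ} (x y : MvPolynomial (Fin n) R) :
    MvPolynomial (Fin n) R :=
  MvPolynomial.C (t ^ 2) * y + MvPolynomial.C (t - 1) * x + MvPolynomial.C t * x ^ 2

open MvPolynomial

/-- An algebra endomorphism fixing the variables in `s` fixes every polynomial in them. -/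
theorem MvPolynomial.eq_self_of_mem_supported {σ S : Type*} [CommRing S] {s : Set σ}
    (φ : MvPolynomial σ S →ₐ[S] MvPolynomial σ S) (hφ : ∀ j ∈ s, φ (X j) = X j)
    {f : MvPolynomial σ S} (hf : f ∈ supported S s) : φ f = f := by
  have h : supported S s ≤ AlgHom.equalizer φ (AlgHom.id S _) := by
    refine Algebra.adjoin_le ?_
    rintro _ ⟨j, hj, rfl⟩
    exact hφ j hj
  exact h hf

/-- The endomorphism sending `Xᵢ` to `Xᵢ + f` and fixing the other variables. -/
def addToVar {S : Type*} [CommRing S] {n : ℕ} (i : Fin n) (f : MvPolynomial (Fin n) S) :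
    MvPolynomial (Fin n) S →ₐ[S] MvPolynomial (Fin n) S :=
  aeval (Function.update X i (X i + f))

theorem addToVar_X_self {S : Type*} [CommRing S] {n : ℕ} (i : Fin n)
    (f : MvPolynomial (Fin n) S) : addToVar i f (X i) = X i + f := by
  simp [addToVar]

theorem addToVar_X_of_ne {S : Type*} [CommRing S] {n : ℕ} {i j : Fin n} (h : j ≠ i)
    (f : MvPolynomial (Fin n) S) : addToVar i f (X j) = X j := by
  simp [addToVar, Function.update_of_ne h]

theorem addToVar_comp_addToVar {S : Type*} [CommRing S] {n : ℕ} {i : Fin n}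
    {f g : MvPolynomial (Fin n) S} (hg : g ∈ supported S {j | j ≠ i}) (h : f + g = 0) :
    (addToVar i f).comp (addToVar i g) = AlgHom.id S _ := by
  ext1 j
  by_cases hj : j = i
  · subst hj
    have hfg := eq_self_of_mem_supported (addToVar j f) (fun k hk => addToVar_X_of_ne hk f) hg
    simp [addToVar_X_self, hfg, add_assoc, h]
  · simp [addToVar_X_of_ne hj]

/-- The elementary automorphism sending `Xᵢ` to `Xᵢ + f` is tame; its inverse sends `Xᵢ` to
`Xᵢ - f`. -/
theorem exists_tame_X_add {S : Type*} [CommRing S] {n : ℕ} (i : Fin n) (f : MvPolynomial (Fin n) S)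
    (hf : f ∈ supported S {j | j ≠ i}) :
    ∃ σ ∈ TameSubgroup S n, σ (X i) = X i + f ∧ σ⁻¹ (X i) = X i - f ∧
      ∀ j ≠ i, σ (X j) = X j ∧ σ⁻¹ (X j) = X j := by
  refine ⟨AlgEquiv.ofAlgHom (addToVar i f) (addToVar i (-f))
    (addToVar_comp_addToVar (neg_mem hf) (add_neg_cancel f))
    (addToVar_comp_addToVar hf (neg_add_cancel f)),
    Subgroup.subset_closure
      (Or.inr ⟨i, f, hf, addToVar_X_self i f, fun _ hj => addToVar_X_of_ne hj f⟩),
    addToVar_X_self i f, ?_,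
    fun j hj => ⟨addToVar_X_of_ne hj f, addToVar_X_of_ne hj (-f)⟩⟩
  rw [sub_eq_add_neg]
  exact addToVar_X_self i (-f)

@[simp]
theorem MvPolynomial.bind₁_ofNat {σ τ R : Type*} [CommRing R] (f : σ → MvPolynomial τ R) (n : ℕ)
    [n.AtLeastTwo] : bind₁ f (ofNat(n) : MvPolynomial σ R) = ofNat(n) :=
  map_ofNat (bind₁ f) n

/-- The linear automorphism `X₀ ↦ X₁`, `X₁ ↦ -X₀`, `X₂ ↦ X₂`. -/
def quarterTurn (S : Type*) [CommRing S] : MvPolynomial (Fin 3) S ≃ₐ[S] MvPolynomial (Fin 3) S :=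
  AlgEquiv.ofAlgHom (aeval ![X 1, -X 0, X 2]) (aeval ![-X 1, X 0, X 2])
    (by ext1 j; fin_cases j <;> simp) (by ext1 j; fin_cases j <;> simp)

theorem quarterTurn_apply {S : Type*} [CommRing S] (p : MvPolynomial (Fin 3) S) :
    quarterTurn S p = aeval ![X 1, -X 0, X 2] p := rfl

theorem quarterTurn_mem_tameSubgroup (S : Type*) [CommRing S] :
    quarterTurn S ∈ TameSubgroup S 3 := by
  refine Subgroup.subset_closure (Or.inl ⟨!![0, 1, 0; -1, 0, 0; 0, 0, 1], ?_, 0, fun i => ?_⟩)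
  · simp [Matrix.det_fin_three]
  · fin_cases i <;> simp [quarterTurn_apply, Fin.sum_univ_three]

@[simp]
theorem MvPolynomial.C_two {σ R : Type*} [CommRing R] : (C 2 : MvPolynomial σ R) = 2 :=
  map_ofNat C 2

/-- The automorphism of `R[X, Y]` given by the length-four example. -/
def exAut {R : Type*} [CommRing R] (t : R) :
    MvPolynomial (Fin 2) R ≃ₐ[R] MvPolynomial (Fin 2) R :=
  let W : MvPolynomial (Fin 2) R := C t * X 0 - X 1 + X 1 ^ 2
  AlgEquiv.ofAlgHom (aeval ![exP t (X 0) (X 1), exQ t (X 0) (X 1)])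
    (aeval ![-X 1 + C t * W, X 0 - W + C 2 * X 1 * W - C t * W ^ 2])
    (by
      ext1 j
      fin_cases j <;> simp [W, exP, exQ, algebraMap_eq] <;> ring)
    (by
      ext1 j
      fin_cases j <;> simp [exP, exQ, algebraMap_eq] <;> ring)

theorem exAut_apply {R : Type*} [CommRing R] (t : R) (p : MvPolynomial (Fin 2) R) :
    exAut t p = aeval ![exP t (X 0) (X 1), exQ t (X 0) (X 1)] p := rfl

/-- Let `R` be an integral domain and `t ∈ R`. The `R`-algebra
endomorphism of `R[X,Y,Z]` sending `X, Y` to the two coordinates of the length-four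
example and fixing `Z` is an automorphism belonging to `Tame₃(R)`; in particular the
pair induces an `R`-algebra automorphism of `R[X,Y]`, which is thus stably tame with
one added variable. -/
theorem stmt_14 {R : Type*} [CommRing R] [IsDomain R] (t : R) :
    (∃ σ : MvPolynomial (Fin 3) R ≃ₐ[R] MvPolynomial (Fin 3) R,
      σ (MvPolynomial.X 0) = exP t (MvPolynomial.X 0) (MvPolynomial.X 1) ∧
      σ (MvPolynomial.X 1) = exQ t (MvPolynomial.X 0) (MvPolynomial.X 1) ∧
      σ (MvPolynomial.X 2) = MvPolynomial.X 2 ∧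
      σ ∈ TameSubgroup R 3) ∧
    ∃ τ : MvPolynomial (Fin 2) R ≃ₐ[R] MvPolynomial (Fin 2) R,
      τ (MvPolynomial.X 0) = exP t (MvPolynomial.X 0) (MvPolynomial.X 1) ∧
      τ (MvPolynomial.X 1) = exQ t (MvPolynomial.X 0) (MvPolynomial.X 1) := by
  refine ⟨?_, exAut t, by simp [exAut_apply], by simp [exAut_apply]⟩
  have hX {i j : Fin 3} (h : j ≠ i) :
      (X j : MvPolynomial (Fin 3) R) ∈ supported R {k | k ≠ i} :=
    Algebra.subset_adjoin ⟨j, h, rfl⟩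
  have hC (i : Fin 3) (a : R) : (C a : MvPolynomial (Fin 3) R) ∈ supported R {k | k ≠ i} :=
    Subalgebra.algebraMap_mem _ a
  obtain ⟨A, hA, A0, A0', hA'⟩ := exists_tame_X_add (0 : Fin 3) (C (-t) * X 2)
    (mul_mem (hC 0 _) (hX (by decide)))
  obtain ⟨B, hB, B1, B1', hB'⟩ := exists_tame_X_add (1 : Fin 3)
    (X 2 + 2 * X 0 * X 2 + C (-t) * X 2 ^ 2)
    (add_mem (add_mem (hX (by decide))
      (mul_mem (mul_mem (ofNat_mem _ 2) (hX (by decide))) (hX (by decide))))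
      (mul_mem (hC 1 _) (pow_mem (hX (by decide)) 2)))
  obtain ⟨T, hT, T2, T2', hT'⟩ := exists_tame_X_add (2 : Fin 3) (C t * X 1 + X 0 + X 0 ^ 2)
    (add_mem (add_mem (mul_mem (hC 2 _) (hX (by decide))) (hX (by decide)))
      (pow_mem (hX (by decide)) 2))
  obtain ⟨A1, A1'⟩ := hA' 1 (by decide)
  obtain ⟨A2, A2'⟩ := hA' 2 (by decide)
  obtain ⟨B0, B0'⟩ := hB' 0 (by decide)
  obtain ⟨B2, B2'⟩ := hB' 2 (by decide)
  obtain ⟨T0, T0'⟩ := hT' 0 (by decide)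
  obtain ⟨T1, T1'⟩ := hT' 1 (by decide)
  have fixC (φ : MvPolynomial (Fin 3) R ≃ₐ[R] MvPolynomial (Fin 3) R) (a : R) :
      φ (C a) = C a := φ.commutes a
  obtain ⟨G, hG, G0, G1, G2⟩ : ∃ G ∈ TameSubgroup R 3,
      G (X 0) = -exQ t (X 0) (X 1) ∧ G (X 1) = exP t (X 0) (X 1) ∧ G (X 2) = X 2 := by
    refine ⟨T * (B * A) * T⁻¹ * (B * A)⁻¹,
      mul_mem (mul_mem (mul_mem hT (mul_mem hB hA)) (inv_mem hT)) (inv_mem (mul_mem hB hA)),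
      ?_, ?_, ?_⟩ <;>
    · simp only [mul_inv_rev, AlgEquiv.mul_apply, map_add, map_sub, map_mul, map_pow, map_neg,
        map_ofNat, map_one, fixC, A0, A1, A2, A0', A1', A2', B0, B1, B2, B0', B1', B2', T0, T1, T2,
        T0', T1', T2', exP, exQ]
      ring
  refine ⟨G * quarterTurn R, ?_, ?_, ?_, mul_mem hG (quarterTurn_mem_tameSubgroup R)⟩ <;>
  simp [quarterTurn_apply, G0, G1, G2]

end
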